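/- arXiv:1202.1443 — 2 statements merged into one kernel-verified Lean document; each statement's English description precedes it below -/
import Mathlib

section
/- For every partition Π = {0 = t_0 < t_1 < ⋯ < t_n = T} of [0,T], every 0 ≤ t ≤ t_l ∈ Π, and every couple of NAD strategies (α, β) ∈ A^Π_{t,t_l} × B^Π_{t,t_l}, there exists a unique couple of admissible controls (u, v) ∈ U^Π_{t,t_l} × V^Π_{t,t_l} such that α(v) = u and β(u) = v, ds⊗dP-almost everywhere on [t,t_l] × Ω. -/
open MeasureTheory Set Filter Topology
open scoped unitInterval RealInnerProductSpace ENNReal NNReal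

noncomputable section

namespace DGameFormal

/-! ### The canonical sample space `Ω = ([0,1]²)^ℕ` -/

/-- The sample space `Ω = ([0,1]²)^ℕ`.  The `j`-th coordinate mapping `ζ_{j+1}` of the paper is
`ω ↦ ω j` (we use `0`-based indexing, so the paper's `ζ_j`, `j ≥ 1`, is `ω ↦ ω (j-1)`). -/
abbrev Omega : Type := ℕ → (I × I)

/-- `𝓕_j`: the σ-field generated by the first `j` coordinate mappings `ζ_1, …, ζ_j`. -/
def Fsig (j : ℕ) : MeasurableSpace Omega :=
  MeasurableSpace.comap (fun ω (i : Fin j) => ω (i : ℕ)) inferInstance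

/-- `𝓖_{j+1}`: the σ-field generated by the first component of the coordinate `ζ_{j+1}`. -/
def Gsig (j : ℕ) : MeasurableSpace Omega :=
  MeasurableSpace.comap (fun ω => (ω j).1) inferInstance

/-- `𝓗_{j+1}`: the σ-field generated by the second component of the coordinate `ζ_{j+1}`. -/
def Hsig (j : ℕ) : MeasurableSpace Omega :=
  MeasurableSpace.comap (fun ω => (ω j).2) inferInstance

/-- `P` is the countable product `λ₂^{⊗ℕ}` of the two-dimensional Lebesgue (Borel) measure on the
unit square: it has the prescribed finite-dimensional distributions. -/
def IsProductMeasure (P : Measure Omega) : Prop :=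
  ∀ m : ℕ, P.map (fun ω (i : Fin m) => ω (i : ℕ))
      = Measure.pi (fun _ : Fin m => (volume : Measure (I × I)))

/-! ### Partitions of `[0,T]` -/

/-- A partition `0 = t_0 < t_1 < ⋯ < t_n = T` of the interval `[0,T]`. -/
structure Partition (T : ℝ) where
  n : ℕ
  npos : 0 < n
  t : ℕ → ℝ
  map_zero : t 0 = 0
  map_last : t n = T
  mono : ∀ i < n, t i < t (i + 1)

/-- The mesh `|Π|`: the maximal distance between two neighbouring points of the partition. -/
def Partition.mesh {T : ℝ} (π : Partition T) : ℝ :=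
  (Finset.range π.n).sup' (Finset.nonempty_range_iff.2 π.npos.ne') fun i => π.t (i + 1) - π.t i

open scoped Classical in
/-- For `t ∈ [t_i, t_{i+1})` the index `i` (and `n - 1` for `t ≥ t_{n-1}`). -/
def Partition.idx {T : ℝ} (π : Partition T) (s : ℝ) : ℕ :=
  Nat.findGreatest (fun i => π.t i ≤ s) (π.n - 1)

/-! ### Admissible controls along a partition -/

variable (U V : Type) [MeasurableSpace U] [MeasurableSpace V]

/-- Admissible controls for Player 1 along the partition `π`: measurable processes `u` such that on
each interval `[t_{j-1}, t_j)` of the partition, `u` is a countable sum `Σ_k 1_{Γ_{j,k}} u^{j,k}`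
where `(Γ_{j,k})_k ⊆ 𝓕_{j-1}` is a partition of `Ω` and each `u^{j,k}` is `𝓖_j`-measurable. -/
def AdmControl1 {T : ℝ} (π : Partition T) : Set (ℝ → Omega → U) :=
  {u | Measurable (Function.uncurry u) ∧
    ∀ j < π.n, ∃ (Γ : ℕ → Set Omega) (w : ℕ → ℝ → Omega → U),
      (∀ k, MeasurableSet[Fsig j] (Γ k)) ∧
      Pairwise (Function.onFun Disjoint Γ) ∧
      (⋃ k, Γ k) = univ ∧
      (∀ k s, Measurable[Gsig j] (w k s)) ∧
      (∀ k, ∀ ω ∈ Γ k, ∀ s ∈ Ico (π.t j) (π.t (j + 1)), u s ω = w k s ω)}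

/-- Admissible controls for Player 2 along the partition `π` (with `𝓗_j` in place of `𝓖_j`). -/
def AdmControl2 {T : ℝ} (π : Partition T) : Set (ℝ → Omega → V) :=
  {v | Measurable (Function.uncurry v) ∧
    ∀ j < π.n, ∃ (Γ : ℕ → Set Omega) (w : ℕ → ℝ → Omega → V),
      (∀ k, MeasurableSet[Fsig j] (Γ k)) ∧
      Pairwise (Function.onFun Disjoint Γ) ∧
      (⋃ k, Γ k) = univ ∧
      (∀ k s, Measurable[Hsig j] (w k s)) ∧
      (∀ k, ∀ ω ∈ Γ k, ∀ s ∈ Ico (π.t j) (π.t (j + 1)), v s ω = w k s ω)}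

/-! ### Nonanticipative strategies with delay (NAD strategies) -/

/-- A stopping time `τ : Ω → {0, 1, …, n-1}` of the discrete filtration `(𝓕_j)_j`. -/
def IsStoppingIdx {T : ℝ} (π : Partition T) (τ : Omega → ℕ) : Prop :=
  (∀ ω, τ ω < π.n) ∧ ∀ j, MeasurableSet[Fsig j] {ω | τ ω = j}

variable {U V}

/-- `u = u'`, `ds⊗dP`-a.e. on the stochastic interval `[[t, b]] = {(s,ω) | t ≤ s ≤ b ω}`. -/
def aeStEq {α : Type*} (P : Measure Omega) (t : ℝ) (b : Omega → ℝ)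
    (u u' : ℝ → Omega → α) : Prop :=
  ∀ᵐ p ∂((volume : Measure ℝ).prod P), t ≤ p.1 → p.1 ≤ b p.2 → u p.1 p.2 = u' p.1 p.2

/-- `u = u'`, `ds⊗dP`-a.e. on `[a,b] × Ω`. -/
def aeEqIcc {α : Type*} (P : Measure Omega) (a b : ℝ) (u u' : ℝ → Omega → α) : Prop :=
  ∀ᵐ p ∂((volume : Measure ℝ).prod P), p.1 ∈ Icc a b → u p.1 p.2 = u' p.1 p.2

variable (U V)

/-- NAD strategies for Player 1 on `[t,T]` along `π`: maps from admissible controls of Player 2 to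
admissible controls of Player 1 such that controls agreeing `ds⊗dP`-a.e. on `[[t, t_τ]]`, for a
stopping time `τ`, are mapped to controls agreeing `ds⊗dP`-a.e. on `[[t, t_{τ+1}]]`. -/
def IsNAD1 {T : ℝ} (P : Measure Omega) (π : Partition T) (t : ℝ)
    (α : (ℝ → Omega → V) → (ℝ → Omega → U)) : Prop :=
  (∀ v ∈ AdmControl2 V π, α v ∈ AdmControl1 U π) ∧
  ∀ τ : Omega → ℕ, IsStoppingIdx π τ →
    ∀ v v', v ∈ AdmControl2 V π → v' ∈ AdmControl2 V π →
      aeStEq P t (fun ω => π.t (τ ω)) v v' →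
      aeStEq P t (fun ω => π.t (τ ω + 1)) (α v) (α v')

/-- NAD strategies for Player 2 on `[t,T]` along `π`. -/
def IsNAD2 {T : ℝ} (P : Measure Omega) (π : Partition T) (t : ℝ)
    (β : (ℝ → Omega → U) → (ℝ → Omega → V)) : Prop :=
  (∀ u ∈ AdmControl1 U π, β u ∈ AdmControl2 V π) ∧
  ∀ τ : Omega → ℕ, IsStoppingIdx π τ →
    ∀ u u', u ∈ AdmControl1 U π → u' ∈ AdmControl1 U π →
      aeStEq P t (fun ω => π.t (τ ω)) u u' →
      aeStEq P t (fun ω => π.t (τ ω + 1)) (β u) (β u')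

/-! ### The controlled dynamics -/

variable {U V}
variable {d : ℕ}

/-- `X` is the (continuous) solution on `[t,T]` of `X_s = x + ∫_t^s f(r, X_r, u_r, v_r) dr`. -/
def IsSol (f : ℝ → EuclideanSpace ℝ (Fin d) → U → V → EuclideanSpace ℝ (Fin d)) (T t : ℝ)
    (x : EuclideanSpace ℝ (Fin d)) (u : ℝ → U) (v : ℝ → V)
    (X : ℝ → EuclideanSpace ℝ (Fin d)) : Prop :=
  ContinuousOn X (Icc t T) ∧ ∀ s ∈ Icc t T, X s = x + ∫ r in t..s, f r (X r) (u r) (v r)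

/-- The solution `X^{t,x,u,v}` (chosen via the axiom of choice; under the standing assumptions it
is the unique continuous solution). -/
def sol (f : ℝ → EuclideanSpace ℝ (Fin d) → U → V → EuclideanSpace ℝ (Fin d)) (T t : ℝ)
    (x : EuclideanSpace ℝ (Fin d)) (u : ℝ → U) (v : ℝ → V) : ℝ → EuclideanSpace ℝ (Fin d) :=
  Classical.epsilon (IsSol f T t x u v)

/-- `(u,v)` is the couple of admissible controls associated with the couple of NAD strategies
`(α,β)` on `[t, tl]`:  `α(v) = u` and `β(u) = v`, `ds⊗dP`-a.e. on `[t,tl] × Ω`. -/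
def IsFixPair {T : ℝ} (P : Measure Omega) (π : Partition T) (t tl : ℝ)
    (α : (ℝ → Omega → V) → (ℝ → Omega → U)) (β : (ℝ → Omega → U) → (ℝ → Omega → V))
    (u : ℝ → Omega → U) (v : ℝ → Omega → V) : Prop :=
  u ∈ AdmControl1 U π ∧ v ∈ AdmControl2 V π ∧ aeEqIcc P t tl (α v) u ∧ aeEqIcc P t tl (β u) v

variable [Nonempty U] [Nonempty V]

/-- The couple of admissible controls associated with a couple of NAD strategies on `[t,tl]`
(chosen via the axiom of choice; by Lemma 2.1 it exists and is `ds⊗dP`-a.e. unique). -/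
def fixPair {T : ℝ} (P : Measure Omega) (π : Partition T) (t tl : ℝ)
    (α : (ℝ → Omega → V) → (ℝ → Omega → U)) (β : (ℝ → Omega → U) → (ℝ → Omega → V)) :
    (ℝ → Omega → U) × (ℝ → Omega → V) :=
  Classical.epsilon fun p => IsFixPair P π t tl α β p.1 p.2

/-- The state process `X^{t,x,α,β}` associated with a couple of NAD strategies on `[t,tl]`. -/
def solStrat (f : ℝ → EuclideanSpace ℝ (Fin d) → U → V → EuclideanSpace ℝ (Fin d)) {T : ℝ}
    (P : Measure Omega) (π : Partition T) (t tl : ℝ) (x : EuclideanSpace ℝ (Fin d))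
    (α : (ℝ → Omega → V) → (ℝ → Omega → U)) (β : (ℝ → Omega → U) → (ℝ → Omega → V))
    (s : ℝ) (ω : Omega) : EuclideanSpace ℝ (Fin d) :=
  sol f T t x (fun r => (fixPair P π t tl α β).1 r ω) (fun r => (fixPair P π t tl α β).2 r ω) s

/-- The terminal pay-off `g(X_T^{t,x,α,β})`. -/
def payoff (f : ℝ → EuclideanSpace ℝ (Fin d) → U → V → EuclideanSpace ℝ (Fin d))
    (g : EuclideanSpace ℝ (Fin d) → ℝ) {T : ℝ} (P : Measure Omega) (π : Partition T)
    (t : ℝ) (x : EuclideanSpace ℝ (Fin d))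
    (α : (ℝ → Omega → V) → (ℝ → Omega → U)) (β : (ℝ → Omega → U) → (ℝ → Omega → V)) :
    Omega → ℝ :=
  fun ω => g (solStrat f P π t T x α β T ω)

/-! ### Essential suprema/infima of families of random variables -/

/-- `S` is the `P`-a.s. least upper bound of the family `(ξ_i)_{i}` of random variables. -/
def IsEssSupFam {ι : Sort*} (P : Measure Omega) (ξ : ι → Omega → ℝ) (S : Omega → ℝ) : Prop :=
  (∀ i, ξ i ≤ᵐ[P] S) ∧ ∀ W : Omega → ℝ, (∀ i, ξ i ≤ᵐ[P] W) → S ≤ᵐ[P] W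

/-- `S` is the `P`-a.s. greatest lower bound of the family `(ξ_i)_{i}` of random variables. -/
def IsEssInfFam {ι : Sort*} (P : Measure Omega) (ξ : ι → Omega → ℝ) (S : Omega → ℝ) : Prop :=
  (∀ i, S ≤ᵐ[P] ξ i) ∧ ∀ W : Omega → ℝ, (∀ i, W ≤ᵐ[P] ξ i) → W ≤ᵐ[P] S

/-! ### Value functions along a partition -/

variable (U V)

/-- The defining property of the lower value function along `π`:
`S = esssup_{α} essinf_{β} E[g(X_T^{t,x,α,β}) | 𝓕_i]` for `t_i ≤ t < t_{i+1}`. -/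
def IsLowerVal (f : ℝ → EuclideanSpace ℝ (Fin d) → U → V → EuclideanSpace ℝ (Fin d))
    (g : EuclideanSpace ℝ (Fin d) → ℝ) {T : ℝ} (P : Measure Omega) (π : Partition T)
    (t : ℝ) (x : EuclideanSpace ℝ (Fin d)) (S : Omega → ℝ) : Prop :=
  ∃ J : {α // IsNAD1 U V P π t α} → Omega → ℝ,
    (∀ α, IsEssInfFam P
      (fun β : {β // IsNAD2 U V P π t β} => P[payoff f g P π t x α.1 β.1 | Fsig (π.idx t)])
      (J α)) ∧
    IsEssSupFam P J S

/-- The defining property of the upper value function along `π`. -/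
def IsUpperVal (f : ℝ → EuclideanSpace ℝ (Fin d) → U → V → EuclideanSpace ℝ (Fin d))
    (g : EuclideanSpace ℝ (Fin d) → ℝ) {T : ℝ} (P : Measure Omega) (π : Partition T)
    (t : ℝ) (x : EuclideanSpace ℝ (Fin d)) (S : Omega → ℝ) : Prop :=
  ∃ J : {β // IsNAD2 U V P π t β} → Omega → ℝ,
    (∀ β, IsEssSupFam P
      (fun α : {α // IsNAD1 U V P π t α} => P[payoff f g P π t x α.1 β.1 | Fsig (π.idx t)])
      (J β)) ∧
    IsEssInfFam P J S

/-- The lower value function along `π` seen as a random variable. -/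
def lowerVal (f : ℝ → EuclideanSpace ℝ (Fin d) → U → V → EuclideanSpace ℝ (Fin d))
    (g : EuclideanSpace ℝ (Fin d) → ℝ) {T : ℝ} (P : Measure Omega) (π : Partition T)
    (t : ℝ) (x : EuclideanSpace ℝ (Fin d)) : Omega → ℝ :=
  Classical.epsilon (IsLowerVal U V f g P π t x)

/-- The upper value function along `π` seen as a random variable. -/
def upperVal (f : ℝ → EuclideanSpace ℝ (Fin d) → U → V → EuclideanSpace ℝ (Fin d))
    (g : EuclideanSpace ℝ (Fin d) → ℝ) {T : ℝ} (P : Measure Omega) (π : Partition T)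
    (t : ℝ) (x : EuclideanSpace ℝ (Fin d)) : Omega → ℝ :=
  Classical.epsilon (IsUpperVal U V f g P π t x)

/-- The (deterministic) lower value function along `π`: the expectation of `lowerVal`. -/
def lowerValD (f : ℝ → EuclideanSpace ℝ (Fin d) → U → V → EuclideanSpace ℝ (Fin d))
    (g : EuclideanSpace ℝ (Fin d) → ℝ) {T : ℝ} (P : Measure Omega) (π : Partition T)
    (t : ℝ) (x : EuclideanSpace ℝ (Fin d)) : ℝ :=
  ∫ ω, lowerVal U V f g P π t x ω ∂P

/-- The (deterministic) upper value function along `π`: the expectation of `upperVal`. -/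
def upperValD (f : ℝ → EuclideanSpace ℝ (Fin d) → U → V → EuclideanSpace ℝ (Fin d))
    (g : EuclideanSpace ℝ (Fin d) → ℝ) {T : ℝ} (P : Measure Omega) (π : Partition T)
    (t : ℝ) (x : EuclideanSpace ℝ (Fin d)) : ℝ :=
  ∫ ω, upperVal U V f g P π t x ω ∂P

/-! ### The Hamiltonian and viscosity solutions -/

section Hamiltonian

variable (U V : Type) [MetricSpace U] [MetricSpace V] [MeasurableSpace U] [MeasurableSpace V]

/-- `f̃(t,x,μ,ν) = ∫_U ∫_V f(t,x,u,v) μ(du) ν(dv)` for mixed actions `μ ∈ Δ(U)`, `ν ∈ Δ(V)`. -/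
def ftilde (f : ℝ → EuclideanSpace ℝ (Fin d) → U → V → EuclideanSpace ℝ (Fin d))
    (t : ℝ) (x : EuclideanSpace ℝ (Fin d)) (μ : ProbabilityMeasure U) (ν : ProbabilityMeasure V) :
    EuclideanSpace ℝ (Fin d) :=
  ∫ u, ∫ v, f t x u v ∂(ν : Measure V) ∂(μ : Measure U)

/-- The Hamiltonian `sup_{μ ∈ ΔU} inf_{ν ∈ ΔV} f̃(t,x,μ,ν)·p`. -/
def ham (f : ℝ → EuclideanSpace ℝ (Fin d) → U → V → EuclideanSpace ℝ (Fin d))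
    (t : ℝ) (x p : EuclideanSpace ℝ (Fin d)) : ℝ :=
  ⨆ μ : ProbabilityMeasure U, ⨅ ν : ProbabilityMeasure V, ⟪ftilde U V f t x μ ν, p⟫

/-- Viscosity subsolution of `∂_t W + sup_μ inf_ν f̃(t,x,μ,ν)·∇W = 0`, `W(T,·) = g`, on
`[0,T] × ℝ^d`. -/
def IsViscSubsol (f : ℝ → EuclideanSpace ℝ (Fin d) → U → V → EuclideanSpace ℝ (Fin d))
    (g : EuclideanSpace ℝ (Fin d) → ℝ) (T : ℝ) (W : ℝ → EuclideanSpace ℝ (Fin d) → ℝ) : Prop :=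
  (∀ x, W T x ≤ g x) ∧
  ∀ φ : ℝ → EuclideanSpace ℝ (Fin d) → ℝ,
    ContDiff ℝ 1 (fun q : ℝ × EuclideanSpace ℝ (Fin d) => φ q.1 q.2) →
    ∀ t x, t ∈ Ico (0 : ℝ) T →
      IsLocalMaxOn (fun q : ℝ × EuclideanSpace ℝ (Fin d) => W q.1 q.2 - φ q.1 q.2)
        (Icc (0 : ℝ) T ×ˢ univ) (t, x) →
      0 ≤ deriv (fun s => φ s x) t + ham U V f t x (gradient (fun y => φ t y) x)

/-- Viscosity supersolution of `∂_t W + sup_μ inf_ν f̃(t,x,μ,ν)·∇W = 0`, `W(T,·) = g`, on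
`[0,T] × ℝ^d`. -/
def IsViscSupersol (f : ℝ → EuclideanSpace ℝ (Fin d) → U → V → EuclideanSpace ℝ (Fin d))
    (g : EuclideanSpace ℝ (Fin d) → ℝ) (T : ℝ) (W : ℝ → EuclideanSpace ℝ (Fin d) → ℝ) : Prop :=
  (∀ x, g x ≤ W T x) ∧
  ∀ φ : ℝ → EuclideanSpace ℝ (Fin d) → ℝ,
    ContDiff ℝ 1 (fun q : ℝ × EuclideanSpace ℝ (Fin d) => φ q.1 q.2) →
    ∀ t x, t ∈ Ico (0 : ℝ) T →
      IsLocalMinOn (fun q : ℝ × EuclideanSpace ℝ (Fin d) => W q.1 q.2 - φ q.1 q.2)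
        (Icc (0 : ℝ) T ×ˢ univ) (t, x) →
      deriv (fun s => φ s x) t + ham U V f t x (gradient (fun y => φ t y) x) ≤ 0

end Hamiltonian

section FixPair

theorem AdmControl1.const_mem {U : Type} [MeasurableSpace U] {T : ℝ} (π : Partition T) (a : U) :
    (fun _ _ => a) ∈ AdmControl1 U π := by
  refine ⟨measurable_const, fun j _ => ⟨fun k => {_ω | k = 0}, fun _ _ _ => a,
    fun k => MeasurableSet.const _, fun i k hik => ?_, ?_, fun _ _ => measurable_const,
    fun _ _ _ _ _ => rfl⟩⟩
  · refine Set.disjoint_left.2 fun ω hi hk => hik ?_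
    exact Eq.trans (show i = 0 from hi) (show k = 0 from hk).symm
  · exact Set.eq_univ_of_forall fun ω => Set.mem_iUnion.2 ⟨0, rfl⟩

theorem AdmControl2.const_mem {V : Type} [MeasurableSpace V] {T : ℝ} (π : Partition T) (a : V) :
    (fun _ _ => a) ∈ AdmControl2 V π := by
  refine ⟨measurable_const, fun j _ => ⟨fun k => {_ω | k = 0}, fun _ _ _ => a,
    fun k => MeasurableSet.const _, fun i k hik => ?_, ?_, fun _ _ => measurable_const,
    fun _ _ _ _ _ => rfl⟩⟩
  · refine Set.disjoint_left.2 fun ω hi hk => hik ?_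
    exact Eq.trans (show i = 0 from hi) (show k = 0 from hk).symm
  · exact Set.eq_univ_of_forall fun ω => Set.mem_iUnion.2 ⟨0, rfl⟩

theorem Partition.t_le_of_le {T : ℝ} (π : Partition T) {k l : ℕ} (hkl : k ≤ l) (hl : l ≤ π.n) :
    π.t k ≤ π.t l := by
  induction l, hkl using Nat.le_induction with
  | base => exact le_rfl
  | succ m _ ih => exact (ih (by omega)).trans (π.mono m (by omega)).le

theorem isStoppingIdx_const {T : ℝ} (π : Partition T) {k : ℕ} (hk : k < π.n) :
    IsStoppingIdx π fun _ => k :=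
  ⟨fun _ => hk, fun _ => MeasurableSet.const _⟩

theorem aeStEq_const_iff {γ : Type*} {P : Measure Omega} {a b : ℝ} {u u' : ℝ → Omega → γ} :
    aeStEq P a (fun _ => b) u u' ↔ aeEqIcc P a b u u' := by
  simp only [aeStEq, aeEqIcc, Set.mem_Icc, and_imp]

namespace aeEqIcc

variable {γ : Type*} {P : Measure Omega} {a b c : ℝ} {u v w : ℝ → Omega → γ}

theorem symm (h : aeEqIcc P a b u v) : aeEqIcc P a b v u :=
  h.mono fun _ hp hs => (hp hs).symm

theorem trans (h : aeEqIcc P a b u v) (h' : aeEqIcc P a b v w) : aeEqIcc P a b u w := by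
  filter_upwards [h, h'] with p hp hp' hs using (hp hs).trans (hp' hs)

theorem mono_right (h : aeEqIcc P a b u v) (hcb : c ≤ b) : aeEqIcc P a c u v :=
  h.mono fun _ hp hs => hp ⟨hs.1, hs.2.trans hcb⟩

theorem of_le (hba : b ≤ a) : aeEqIcc P a b u v := by
  have hne : ∀ᵐ s ∂(volume : Measure ℝ), s ≠ a := by
    simp [ae_iff]
  filter_upwards [Measure.quasiMeasurePreserving_fst.ae hne] with p hp hs
  exact absurd (le_antisymm (hs.2.trans hba) hs.1) hp

end aeEqIcc

section NAD

variable {U V : Type} [MeasurableSpace U] [MeasurableSpace V] {T : ℝ} {P : Measure Omega}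
  {π : Partition T} {t : ℝ} {k : ℕ}

theorem IsNAD1.aeEqIcc_succ {α : (ℝ → Omega → V) → (ℝ → Omega → U)} (hα : IsNAD1 U V P π t α)
    (hk : k < π.n) {v v' : ℝ → Omega → V} (hv : v ∈ AdmControl2 V π) (hv' : v' ∈ AdmControl2 V π)
    (h : aeEqIcc P t (π.t k) v v') : aeEqIcc P t (π.t (k + 1)) (α v) (α v') :=
  aeStEq_const_iff.1 (hα.2 _ (isStoppingIdx_const π hk) v v' hv hv' (aeStEq_const_iff.2 h))

theorem IsNAD2.aeEqIcc_succ {β : (ℝ → Omega → U) → (ℝ → Omega → V)} (hβ : IsNAD2 U V P π t β)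
    (hk : k < π.n) {u u' : ℝ → Omega → U} (hu : u ∈ AdmControl1 U π) (hu' : u' ∈ AdmControl1 U π)
    (h : aeEqIcc P t (π.t k) u u') : aeEqIcc P t (π.t (k + 1)) (β u) (β u') :=
  aeStEq_const_iff.1 (hβ.2 _ (isStoppingIdx_const π hk) u u' hu hu' (aeStEq_const_iff.2 h))

theorem IsFixPair.unique {α : (ℝ → Omega → V) → (ℝ → Omega → U)}
    {β : (ℝ → Omega → U) → (ℝ → Omega → V)} (hα : IsNAD1 U V P π t α) (hβ : IsNAD2 U V P π t β)
    (ht : 0 ≤ t) {l : ℕ} (hl : l ≤ π.n) {u u' : ℝ → Omega → U} {v v' : ℝ → Omega → V}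
    (h : IsFixPair P π t (π.t l) α β u v) (h' : IsFixPair P π t (π.t l) α β u' v') :
    aeEqIcc P t (π.t l) u' u ∧ aeEqIcc P t (π.t l) v' v := by
  obtain ⟨hu, hv, hαv, hβu⟩ := h
  obtain ⟨hu', hv', hαv', hβu'⟩ := h'
  have key : ∀ k ≤ l, aeEqIcc P t (π.t k) u' u ∧ aeEqIcc P t (π.t k) v' v := by
    intro k
    induction k with
    | zero =>
      intro _
      have h0 : π.t 0 ≤ t := π.map_zero.trans_le ht
      exact ⟨.of_le h0, .of_le h0⟩
    | succ k ih =>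
      intro hk
      obtain ⟨h1, h2⟩ := ih (by omega)
      have hkl := π.t_le_of_le hk hl
      exact ⟨((hαv'.mono_right hkl).symm.trans (hα.aeEqIcc_succ (by omega) hv' hv h2)).trans
          (hαv.mono_right hkl),
        ((hβu'.mono_right hkl).symm.trans (hβ.aeEqIcc_succ (by omega) hu' hu h1)).trans
          (hβu.mono_right hkl)⟩
  exact key l le_rfl

theorem exists_isFixPair [Nonempty U] [Nonempty V] {α : (ℝ → Omega → V) → (ℝ → Omega → U)}
    {β : (ℝ → Omega → U) → (ℝ → Omega → V)} (hα : IsNAD1 U V P π t α) (hβ : IsNAD2 U V P π t β)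
    (ht : 0 ≤ t) {l : ℕ} (hl : l ≤ π.n) :
    ∃ u v, IsFixPair P π t (π.t l) α β u v := by
  induction l with
  | zero =>
    have h0 : π.t 0 ≤ t := π.map_zero.trans_le ht
    exact ⟨_, _, AdmControl1.const_mem π (Classical.arbitrary U),
      AdmControl2.const_mem π (Classical.arbitrary V), .of_le h0, .of_le h0⟩
  | succ k ih =>
    obtain ⟨u, v, hu, hv, hαv, hβu⟩ := ih (by omega)
    have hu' := hα.1 v hv
    have hv' := hβ.1 u hu
    exact ⟨α v, β u, hu', hv', hα.aeEqIcc_succ (by omega) hv' hv hβu,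
      hβ.aeEqIcc_succ (by omega) hu' hu hαv⟩

end NAD

end FixPair

/-- **Lemma 2.1.** For every partition `Π` of `[0,T]`, every `0 ≤ t ≤ t_l ∈ Π`, and
every couple of NAD strategies `(α, β) ∈ A^Π_{t,t_l} × B^Π_{t,t_l}`, there exists a unique (up to
`ds⊗dP`-a.e. equality on `[t,t_l] × Ω`) couple of admissible controls
`(u, v) ∈ U^Π_{t,t_l} × V^Π_{t,t_l}` with `α(v) = u` and `β(u) = v`, `ds⊗dP`-a.e. on
`[t,t_l] × Ω`. -/
theorem statement_3
    {U V : Type} [MetricSpace U] [CompactSpace U] [MetricSpace V] [CompactSpace V]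
    [MeasurableSpace U] [BorelSpace U] [MeasurableSpace V] [BorelSpace V]
    [Nonempty U] [Nonempty V]
    (T : ℝ) (hT : 0 < T)
    (P : Measure Omega) [IsProbabilityMeasure P] (hP : IsProductMeasure P)
    (π : Partition T) (t : ℝ) (ht : 0 ≤ t) (l : ℕ) (hl : l ≤ π.n) (htl : t ≤ π.t l)
    (α : (ℝ → Omega → V) → (ℝ → Omega → U)) (hα : IsNAD1 U V P π t α)
    (β : (ℝ → Omega → U) → (ℝ → Omega → V)) (hβ : IsNAD2 U V P π t β) :
    ∃ (u : ℝ → Omega → U) (v : ℝ → Omega → V),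
      IsFixPair P π t (π.t l) α β u v ∧
      ∀ (u' : ℝ → Omega → U) (v' : ℝ → Omega → V), IsFixPair P π t (π.t l) α β u' v' →
        aeEqIcc P t (π.t l) u' u ∧ aeEqIcc P t (π.t l) v' v := by
  obtain ⟨u, v, h⟩ := exists_isFixPair hα hβ ht hl
  exact ⟨u, v, h, fun _ _ h' => h.unique hα hβ ht hl h'⟩

end DGameFormal
end
end

section
/- For a partition Π = {0 = t_0 < ⋯ < t_{n-1} < t_n = T} of [0,T] and every x ∈ ℝ^d, the F_{n-1}-measurable random variable V^Π(t_{n-1}, x) = esssup_{α ∈ A^Π_{t_{n-1},t_n}} essinf_{β ∈ B^Π_{t_{n-1},t_n}} E[g(X_{t_n}^{t_{n-1},x,α,β}) | F_{n-1}] is deterministic, i.e. V^Π(t_{n-1}, x) = E[V^Π(t_{n-1}, x)] P-almost surely. -/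
open MeasureTheory Set Filter Topology
open scoped unitInterval RealInnerProductSpace ENNReal NNReal

noncomputable section

namespace DGameFormal

/-! ### Admissible controls along a partition -/

variable (U V : Type) [MeasurableSpace U] [MeasurableSpace V]

variable {U V}

variable (U V)

/-! ### The controlled dynamics -/

variable {U V}
variable {d : ℕ}

variable [Nonempty U] [Nonempty V]

/-! ### Value functions along a partition -/

variable (U V)

/-! ### Rotations of the unit interval -/

/-- The quotient map from the unit interval to the circle. -/
def toCircle (x : I) : UnitAddCircle := ((x : ℝ) : UnitAddCircle)

/-- The section of `toCircle` with values in `(0, 1]`. -/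
def ofCircle (y : UnitAddCircle) : I :=
  ⟨AddCircle.equivIoc 1 0 y, by
    have h := (AddCircle.equivIoc 1 0 y).2
    exact ⟨h.1.le, by simpa using h.2⟩⟩

lemma toCircle_ofCircle (y : UnitAddCircle) : toCircle (ofCircle y) = y :=
  AddCircle.coe_equivIoc

lemma ofCircle_toCircle {x : I} (hx : x ≠ 0) : ofCircle (toCircle x) = x := by
  apply Subtype.ext
  refine AddCircle.equivIoc_coe_of_mem ⟨?_, ?_⟩
  · exact unitInterval.pos_iff_ne_zero.2 hx
  · simpa using x.2.2

lemma ae_ofCircle_toCircle : ∀ᵐ x : I, ofCircle (toCircle x) = x := by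
  filter_upwards [compl_mem_ae_iff.2 (measure_singleton (0 : I))] with x hx
  exact ofCircle_toCircle hx

lemma measurePreserving_toCircle : MeasurePreserving toCircle := by
  have h := UnitAddCircle.measurePreserving_mk 0
  rw [zero_add, Measure.restrict_congr_set Ioc_ae_eq_Icc] at h
  exact h.comp unitInterval.measurePreserving_coe

instance : IsProbabilityMeasure (volume : Measure UnitAddCircle) :=
  measurePreserving_toCircle.map_eq ▸
    Measure.isProbabilityMeasure_map measurePreserving_toCircle.aemeasurable

lemma measurePreserving_ofCircle : MeasurePreserving ofCircle := by
  have hm : Measurable ofCircle :=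
    (measurable_subtype_coe.comp (AddCircle.measurableEquivIoc 1 0).measurable).subtype_mk
  refine ⟨hm, ?_⟩
  conv_lhs => rw [← measurePreserving_toCircle.map_eq]
  rw [Measure.map_map hm measurePreserving_toCircle.measurable]
  conv_rhs => rw [← Measure.map_id (μ := (volume : Measure I))]
  exact Measure.map_congr ae_ofCircle_toCircle

/-- The rotation of the unit interval (modulo `1`) by the angle `a`. -/
def rotI (a : UnitAddCircle) (x : I) : I := ofCircle (toCircle x + a)

lemma measurable_rotI_uncurry : Measurable fun p : UnitAddCircle × I => rotI p.1 p.2 :=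
  measurePreserving_ofCircle.measurable.comp
    ((measurePreserving_toCircle.measurable.comp measurable_snd).add measurable_fst)

lemma measurePreserving_rotI (a : UnitAddCircle) : MeasurePreserving (rotI a) :=
  measurePreserving_ofCircle.comp
    ((measurePreserving_add_right volume a).comp measurePreserving_toCircle)

lemma measurePreserving_rotI_left (x : I) : MeasurePreserving fun a => rotI a x :=
  measurePreserving_ofCircle.comp (measurePreserving_add_left volume (toCircle x))

lemma rotI_neg_rotI (a : UnitAddCircle) {x : I} (hx : x ≠ 0) : rotI (-a) (rotI a x) = x := by
  simp [rotI, toCircle_ofCircle, ofCircle_toCircle hx]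

/-! ### Coordinatewise rotations of the sample space -/

lemma IsProductMeasure.eq_infinitePi {P : Measure Omega} (hP : IsProductMeasure P) :
    P = Measure.infinitePi fun _ => (volume : Measure (I × I)) := by
  classical
  refine Measure.eq_infinitePi _ fun s t ht => ?_
  obtain ⟨m, hm⟩ : ∃ m, ∀ i ∈ s, i < m :=
    ⟨s.sup id + 1, fun i hi => Nat.lt_succ_of_le (Finset.le_sup (f := id) hi)⟩
  have hset : Set.pi s t = (fun (ω : Omega) (i : Fin m) => ω (i : ℕ)) ⁻¹'
      Set.pi univ fun i : Fin m => if (i : ℕ) ∈ s then t i else univ := by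
    ext ω
    simp only [Set.mem_pi, Finset.mem_coe, mem_preimage, mem_univ, forall_const]
    constructor
    · intro h i
      split_ifs with hi
      · exact h i hi
      · trivial
    · intro h i hi
      simpa [hi] using h ⟨i, hm i hi⟩
  have hmeas : ∀ i : Fin m, MeasurableSet (if (i : ℕ) ∈ s then t i else univ) := by
    intro i
    split_ifs
    · exact ht i
    · exact MeasurableSet.univ
  rw [hset, ← Measure.map_apply (by fun_prop) (MeasurableSet.univ_pi hmeas), hP m,
    Measure.pi_pi]
  have : ∀ i : Fin m, (volume : Measure (I × I)) (if (i : ℕ) ∈ s then t i else univ)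
      = (fun j : ℕ => if j ∈ s then (volume : Measure (I × I)) (t j) else 1) i := by
    intro i
    dsimp only
    split_ifs
    · rfl
    · exact measure_univ
  rw [Finset.prod_congr rfl fun i _ => this i,
    Fin.prod_univ_eq_prod_range (fun j : ℕ => if j ∈ s then (volume : Measure (I × I)) (t j) else 1),
    Finset.prod_ite_mem]
  congr 1
  ext i
  simpa using hm i

/-- The coordinatewise rotation of the sample space by a sequence of pairs of angles. -/
def rot (a : ℕ → UnitAddCircle × UnitAddCircle) (ω : Omega) : Omega :=
  fun i => (rotI (a i).1 (ω i).1, rotI (a i).2 (ω i).2)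

lemma measurable_rot_uncurry :
    Measurable (Function.uncurry fun (ω : Omega) (a : ℕ → UnitAddCircle × UnitAddCircle) =>
      rot a ω) := by
  refine measurable_pi_lambda _ fun i => Measurable.prodMk ?_ ?_
  · exact measurable_rotI_uncurry.comp (f := fun p : Omega × (ℕ → UnitAddCircle × UnitAddCircle) =>
      ((p.2 i).1, (p.1 i).1)) (by fun_prop)
  · exact measurable_rotI_uncurry.comp (f := fun p : Omega × (ℕ → UnitAddCircle × UnitAddCircle) =>
      ((p.2 i).2, (p.1 i).2)) (by fun_prop)

/-- The uniform distribution on sequences of pairs of angles. -/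
def angleMeasure : Measure (ℕ → UnitAddCircle × UnitAddCircle) :=
  Measure.infinitePi fun _ => volume

instance : IsProbabilityMeasure angleMeasure := by
  unfold angleMeasure
  infer_instance

lemma measurePreserving_rot {P : Measure Omega} (hP : IsProductMeasure P)
    (a : ℕ → UnitAddCircle × UnitAddCircle) : MeasurePreserving (rot a) P P := by
  have h (i : ℕ) : MeasurePreserving (Prod.map (rotI (a i).1) (rotI (a i).2)) :=
    (measurePreserving_rotI _).prod (measurePreserving_rotI _)
  refine ⟨measurable_rot_uncurry.comp (measurable_id.prodMk measurable_const), ?_⟩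
  rw [hP.eq_infinitePi]
  refine (Measure.infinitePi_map_pi _ fun i => (h i).measurable).trans ?_
  simp only [(h _).map_eq]

lemma map_rot_left {P : Measure Omega} (hP : IsProductMeasure P) (ω : Omega) :
    Measure.map (fun a => rot a ω) angleMeasure = P := by
  have h (i : ℕ) : MeasurePreserving (Prod.map (fun a => rotI a (ω i).1) fun a => rotI a (ω i).2) :=
    (measurePreserving_rotI_left _).prod (measurePreserving_rotI_left _)
  rw [hP.eq_infinitePi]
  refine (Measure.infinitePi_map_pi _ fun i => (h i).measurable).trans ?_
  simp only [(h _).map_eq]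

lemma ae_rot_neg_rot {P : Measure Omega} (hP : IsProductMeasure P)
    (a : ℕ → UnitAddCircle × UnitAddCircle) : ∀ᵐ ω ∂P, rot (-a) (rot a ω) = ω := by
  have h1 : ∀ᵐ ω ∂P, ∀ i, (ω i).1 ≠ 0 ∧ (ω i).2 ≠ 0 := by
    rw [ae_all_iff]
    intro i
    have hi : MeasurePreserving (fun ω : Omega => ω i) P volume := by
      rw [hP.eq_infinitePi]
      exact measurePreserving_eval_infinitePi _ i
    have h0 : ∀ᵐ x : I, x ≠ 0 := compl_mem_ae_iff.2 (measure_singleton (0 : I))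
    have hfst : MeasurePreserving (Prod.fst : I × I → I) := measurePreserving_fst
    have hsnd : MeasurePreserving (Prod.snd : I × I → I) := measurePreserving_snd
    exact ((hfst.comp hi).quasiMeasurePreserving.ae h0).and
      ((hsnd.comp hi).quasiMeasurePreserving.ae h0)
  filter_upwards [h1] with ω hω
  funext i
  exact Prod.ext (rotI_neg_rotI _ (hω i).1) (rotI_neg_rotI _ (hω i).2)

/-- A measure-preserving map of the sample space that is compatible with the filtration and with
the private information of both players. -/
structure IsCompatible (P : Measure Omega) (θ : Omega → Omega) : Prop where
  measurePreserving : MeasurePreserving θ P P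
  measurable_Fsig : ∀ j, Measurable[Fsig j, Fsig j] θ
  measurable_Gsig : ∀ j, Measurable[Gsig j, Gsig j] θ
  measurable_Hsig : ∀ j, Measurable[Hsig j, Hsig j] θ

lemma measurable_comap_of_semiconj {α β : Type*} [mβ : MeasurableSpace β] {q : α → β}
    {θ : α → α} {r : β → β} (hr : Measurable r) (h : q ∘ θ = r ∘ q) :
    Measurable[mβ.comap q, mβ.comap q] θ := by
  rintro _ ⟨s, hs, rfl⟩
  exact ⟨r ⁻¹' s, hr hs, by rw [← preimage_comp, ← preimage_comp, h]⟩

lemma isCompatible_rot {P : Measure Omega} (hP : IsProductMeasure P)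
    (a : ℕ → UnitAddCircle × UnitAddCircle) : IsCompatible P (rot a) where
  measurePreserving := measurePreserving_rot hP a
  measurable_Fsig j := by
    refine measurable_comap_of_semiconj (r := fun (e : Fin j → I × I) i =>
      (rotI (a i).1 (e i).1, rotI (a i).2 (e i).2)) ?_ rfl
    have := fun b => (measurePreserving_rotI b).measurable
    fun_prop
  measurable_Gsig j := measurable_comap_of_semiconj (measurePreserving_rotI (a j).1).measurable rfl
  measurable_Hsig j := measurable_comap_of_semiconj (measurePreserving_rotI (a j).2).measurable rfl

/-- A function that does not decrease under any coordinatewise rotation is a.s. constant. -/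
lemma ae_eq_const_of_forall_le_rot {P : Measure Omega} [IsProbabilityMeasure P]
    (hP : IsProductMeasure P) {S : Omega → ℝ} (hS : AEMeasurable S P)
    (h : ∀ a, S ≤ᵐ[P] S ∘ rot a) : ∃ c : ℝ, S =ᵐ[P] fun _ => c := by
  obtain ⟨S', hS'm, hSS'⟩ := hS
  have h' : ∀ a, ∀ᵐ ω ∂P, S' ω ≤ S' (rot a ω) := by
    intro a
    filter_upwards [h a, hSS', (measurePreserving_rot hP a).quasiMeasurePreserving.ae hSS']
      with ω h1 h2 h3
    rw [← h2, ← h3]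
    exact h1
  have hmp : MeasurePreserving
      (fun p : Omega × (ℕ → UnitAddCircle × UnitAddCircle) => (p.1, rot p.2 p.1))
      (P.prod angleMeasure) (P.prod P) :=
    (MeasurePreserving.id P).skew_product measurable_rot_uncurry
      (Eventually.of_forall fun ω => map_rot_left hP ω)
  have hms : MeasurableSet {p : Omega × Omega | S' p.1 ≤ S' p.2} :=
    measurableSet_le (hS'm.comp measurable_fst) (hS'm.comp measurable_snd)
  have hle : ∀ᵐ p ∂P.prod P, S' p.1 ≤ S' p.2 := by
    rw [← hmp.map_eq, ae_map_iff hmp.aemeasurable hms]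
    have hms' := hmp.measurable hms
    exact (Measure.ae_prod_iff_ae_ae hms').2
      ((Measure.ae_ae_comm (p := fun ω a => S' ω ≤ S' (rot a ω)) hms').2
        (Eventually.of_forall h'))
  have hge : ∀ᵐ p ∂P.prod P, S' p.2 ≤ S' p.1 :=
    (Measure.measurePreserving_swap (μ := P) (ν := P)).quasiMeasurePreserving.ae hle
  obtain ⟨ω₀, hω₀⟩ := (Measure.ae_ae_of_ae_prod (hle.and hge)).exists
  refine ⟨S' ω₀, hSS'.trans ?_⟩
  filter_upwards [hω₀] with ω hω
  exact le_antisymm hω.2 hω.1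

/-! ### Conditional expectations under compatible maps -/

lemma Fsig_le (j : ℕ) : Fsig j ≤ (inferInstance : MeasurableSpace Omega) :=
  Measurable.comap_le (by fun_prop)

lemma condExp_comp {P : Measure Omega} [IsProbabilityMeasure P] {θ θ' : Omega → Omega}
    (hθ : IsCompatible P θ) (hθ' : IsCompatible P θ') (hinv : ∀ᵐ ω ∂P, θ' (θ ω) = ω)
    (hinv' : ∀ᵐ ω ∂P, θ (θ' ω) = ω) (j : ℕ) (X : Omega → ℝ) :
    P[X | Fsig j] ∘ θ =ᵐ[P] P[X ∘ θ | Fsig j] := by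
  by_cases hX : Integrable X P
  · have hXθ : Integrable (X ∘ θ) P := hθ.measurePreserving.integrable_comp_of_integrable hX
    have hEθ : Integrable (P[X | Fsig j] ∘ θ) P :=
      hθ.measurePreserving.integrable_comp_of_integrable integrable_condExp
    refine ae_eq_condExp_of_forall_setIntegral_eq (Fsig_le j) hXθ
      (fun _ _ _ => hEθ.integrableOn) ?_ ?_
    · intro A hA _
      have hB : MeasurableSet[Fsig j] (θ' ⁻¹' A) := hθ'.measurable_Fsig j hA
      have hAB : A =ᵐ[P] θ ⁻¹' (θ' ⁻¹' A) := by
        filter_upwards [hinv] with ω hω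
        change (ω ∈ A) = (θ' (θ ω) ∈ A)
        rw [hω]
      have key (Y : Omega → ℝ) (hY : Integrable Y P) :
          ∫ ω in A, (Y ∘ θ) ω ∂P = ∫ ω in θ' ⁻¹' A, Y ω ∂P := by
        have hmap := hθ.measurePreserving.map_eq
        rw [setIntegral_congr_set hAB]
        conv_rhs => rw [← hmap]
        exact (setIntegral_map (Fsig_le j _ hB) (by rw [hmap]; exact hY.aestronglyMeasurable)
          hθ.measurePreserving.aemeasurable).symm
      rw [key _ integrable_condExp, key _ hX, setIntegral_condExp (Fsig_le j) hX hB]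
    · exact (stronglyMeasurable_condExp.comp_measurable (hθ.measurable_Fsig j)).aestronglyMeasurable
  · have hXθ : ¬ Integrable (X ∘ θ) P := fun h =>
      hX ((hθ'.measurePreserving.integrable_comp_of_integrable h).congr (by
        filter_upwards [hinv'] with ω hω
        simp only [Function.comp_apply, hω]))
    rw [condExp_of_not_integrable hX, condExp_of_not_integrable hXθ]
    rfl

/-! ### Existence and uniqueness of essential suprema and infima -/

section EssSup

variable {ι : Sort*} {P : Measure Omega} {ξ : ι → Omega → ℝ}

lemma IsEssSupFam.ae_eq {S S' : Omega → ℝ} (h : IsEssSupFam P ξ S) (h' : IsEssSupFam P ξ S') :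
    S =ᵐ[P] S' :=
  (h.2 S' h'.1).antisymm (h'.2 S h.1)

lemma IsEssInfFam.ae_eq {S S' : Omega → ℝ} (h : IsEssInfFam P ξ S) (h' : IsEssInfFam P ξ S') :
    S =ᵐ[P] S' :=
  (h'.2 S h.1).antisymm (h.2 S' h'.1)

lemma exists_isEssSupFam [IsProbabilityMeasure P] [Nonempty ι] {C : ℝ}
    (hm : ∀ i, AEMeasurable (ξ i) P) (hb : ∀ i, ∀ᵐ ω ∂P, |ξ i ω| ≤ C) :
    ∃ S : Omega → ℝ, AEMeasurable S P ∧ (∀ᵐ ω ∂P, |S ω| ≤ C) ∧ IsEssSupFam P ξ S := by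
  let F : ι → Omega → ℝ≥0∞ := fun i ω => ENNReal.ofReal (ξ i ω + C)
  have hF : ∀ i, AEMeasurable (F i) P := fun i => ((hm i).add_const C).ennreal_ofReal
  let M : (ℕ → ι) → ℝ≥0∞ := fun s => ∫⁻ ω, ⨆ k, F (s k) ω ∂P
  obtain ⟨m, -, hmlim, hmM⟩ :=
    exists_seq_tendsto_sSup (range_nonempty M) (OrderTop.bddAbove (range M))
  choose r hr using hmM
  let s : ℕ → ι := fun k => r k.unpair.1 k.unpair.2
  have hmax : ∀ s', M s' ≤ M s := by
    intro s'
    refine (le_sSup (mem_range_self s')).trans (le_of_tendsto hmlim (Eventually.of_forall ?_))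
    intro n
    rw [← hr n]
    refine lintegral_mono fun ω => iSup_le fun k => ?_
    refine le_trans (le_of_eq ?_) (le_iSup (fun l => F (s l) ω) (Nat.pair n k))
    simp [s]
  have hbs : ∀ᵐ ω ∂P, ∀ k, |ξ (s k) ω| ≤ C := ae_all_iff.2 fun k => hb (s k)
  let h : Omega → ℝ≥0∞ := fun ω => ⨆ k, F (s k) ω
  have hh : AEMeasurable h P := AEMeasurable.iSup fun k => hF (s k)
  have hle : ∀ᵐ ω ∂P, h ω ≤ ENNReal.ofReal (C + C) := by
    filter_upwards [hbs] with ω hω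
    exact iSup_le fun k => ENNReal.ofReal_le_ofReal (by linarith [(abs_le.1 (hω k)).2])
  have hfin : ∫⁻ ω, h ω ∂P ≠ ∞ := by
    refine ((lintegral_mono_ae hle).trans_lt ?_).ne
    simp
  have hub : ∀ i, ∀ᵐ ω ∂P, F i ω ≤ h ω := by
    intro i
    let s' : ℕ → ι := fun k => Nat.casesOn k i s
    have hs' : ∀ ω, h ω ≤ ⨆ k, F (s' k) ω := fun ω =>
      iSup_le fun k => le_iSup (fun l => F (s' l) ω) (k + 1)
    filter_upwards [ae_eq_of_ae_le_of_lintegral_le (Eventually.of_forall hs') hfin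
      (AEMeasurable.iSup fun k => hF (s' k)) (hmax s')] with ω hω
    rw [hω]
    exact le_iSup (fun l => F (s' l) ω) 0
  refine ⟨fun ω => (h ω).toReal - C, hh.ennreal_toReal.sub_const C, ?_, ?_, ?_⟩
  · filter_upwards [hle, hbs] with ω hω hω'
    have hC : 0 ≤ C := (abs_nonneg _).trans (hω' 0)
    have := ENNReal.toReal_le_of_le_ofReal (by linarith) hω
    rw [abs_le]
    constructor <;> linarith [ENNReal.toReal_nonneg (a := h ω)]
  · intro i
    filter_upwards [hle, hub i] with ω h1 h2
    have := (ENNReal.ofReal_le_iff_le_toReal (h1.trans_lt ENNReal.ofReal_lt_top).ne).1 h2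
    linarith
  · intro W hW
    filter_upwards [hbs, ae_all_iff.2 fun k => hW (s k)] with ω h1 h2
    have h3 : h ω ≤ ENNReal.ofReal (W ω + C) :=
      iSup_le fun k => ENNReal.ofReal_le_ofReal (by linarith [h2 k])
    have := ENNReal.toReal_le_of_le_ofReal (by linarith [h2 0, (abs_le.1 (h1 0)).1]) h3
    linarith

lemma exists_isEssInfFam [IsProbabilityMeasure P] [Nonempty ι] {C : ℝ}
    (hm : ∀ i, AEMeasurable (ξ i) P) (hb : ∀ i, ∀ᵐ ω ∂P, |ξ i ω| ≤ C) :
    ∃ S : Omega → ℝ, AEMeasurable S P ∧ (∀ᵐ ω ∂P, |S ω| ≤ C) ∧ IsEssInfFam P ξ S := by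
  obtain ⟨S, hSm, hSb, hS1, hS2⟩ := exists_isEssSupFam (P := P) (ξ := fun i => -ξ i) (C := C)
    (fun i => (hm i).neg) (fun i => by simpa using hb i)
  refine ⟨-S, hSm.neg, by simpa using hSb, ?_, ?_⟩
  · intro i
    filter_upwards [hS1 i] with ω hω
    exact neg_le.1 hω
  · intro W hW
    have h := hS2 (-W) fun i => by
      filter_upwards [hW i] with ω hω
      exact neg_le_neg hω
    filter_upwards [h] with ω hω
    exact le_neg.1 hω

end EssSup

/-! ### Controls and strategies on the last interval of the partition -/

lemma aeEqIcc.ae_ae {α : Type*} {P : Measure Omega} [SFinite P] {a b : ℝ}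
    {u u' : ℝ → Omega → α} (h : aeEqIcc P a b u u') :
    ∀ᵐ ω ∂P, ∀ᵐ s : ℝ, s ∈ Icc a b → u s ω = u' s ω :=
  Measure.ae_ae_of_ae_prod ((Measure.measurePreserving_swap (μ := P)
    (ν := (volume : Measure ℝ))).quasiMeasurePreserving.ae h)

lemma sol_congr {U V : Type} {d : ℕ} {T : ℝ}
    {f : ℝ → EuclideanSpace ℝ (Fin d) → U → V → EuclideanSpace ℝ (Fin d)}
    {t : ℝ} {x : EuclideanSpace ℝ (Fin d)} {u u' : ℝ → U} {v v' : ℝ → V}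
    (hu : ∀ᵐ s : ℝ, s ∈ Icc t T → u s = u' s) (hv : ∀ᵐ s : ℝ, s ∈ Icc t T → v s = v' s) :
    sol f T t x u v = sol f T t x u' v' := by
  unfold sol
  congr 1
  funext X
  unfold IsSol
  congr 1
  refine propext (forall₂_congr fun s hs => ?_)
  rw [intervalIntegral.integral_congr_ae]
  filter_upwards [hu, hv] with r h1 h2 hr
  rw [uIoc_of_le hs.1] at hr
  have hr' : r ∈ Icc t T := ⟨hr.1.le, hr.2.trans hs.2⟩
  rw [h1 hr', h2 hr']

/-- The terminal pay-off `g(X_T^{t,x,u,v})` of a couple of controls. -/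
def controlPayoff {U V : Type} {d : ℕ}
    (f : ℝ → EuclideanSpace ℝ (Fin d) → U → V → EuclideanSpace ℝ (Fin d))
    (g : EuclideanSpace ℝ (Fin d) → ℝ) (T t : ℝ) (x : EuclideanSpace ℝ (Fin d))
    (u : ℝ → Omega → U) (v : ℝ → Omega → V) (ω : Omega) : ℝ :=
  g (sol f T t x (fun r => u r ω) (fun r => v r ω) T)

section LastInterval

variable {U V : Type} [MeasurableSpace U] [MeasurableSpace V] {d : ℕ} {T : ℝ}

lemma comp_mem_admControl1 {P : Measure Omega} {π : Partition T} {θ : Omega → Omega}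
    (hθ : IsCompatible P θ) {u : ℝ → Omega → U} (hu : u ∈ AdmControl1 U π) :
    (fun s ω => u s (θ ω)) ∈ AdmControl1 U π := by
  refine ⟨hu.1.comp (measurable_fst.prodMk (hθ.measurePreserving.measurable.comp measurable_snd)),
    fun j hj => ?_⟩
  obtain ⟨Γ, w, h1, h2, h3, h4, h5⟩ := hu.2 j hj
  refine ⟨fun k => θ ⁻¹' Γ k, fun k s ω => w k s (θ ω), fun k => hθ.measurable_Fsig j (h1 k),
    fun k l hkl => (h2 hkl).preimage θ, by rw [← preimage_iUnion, h3, preimage_univ],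
    fun k s => (h4 k s).comp (hθ.measurable_Gsig j), fun k ω hω s hs => h5 k (θ ω) hω s hs⟩

lemma comp_mem_admControl2 {P : Measure Omega} {π : Partition T} {θ : Omega → Omega}
    (hθ : IsCompatible P θ) {v : ℝ → Omega → V} (hv : v ∈ AdmControl2 V π) :
    (fun s ω => v s (θ ω)) ∈ AdmControl2 V π := by
  refine ⟨hv.1.comp (measurable_fst.prodMk (hθ.measurePreserving.measurable.comp measurable_snd)),
    fun j hj => ?_⟩
  obtain ⟨Γ, w, h1, h2, h3, h4, h5⟩ := hv.2 j hj
  refine ⟨fun k => θ ⁻¹' Γ k, fun k s ω => w k s (θ ω), fun k => hθ.measurable_Fsig j (h1 k),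
    fun k l hkl => (h2 hkl).preimage θ, by rw [← preimage_iUnion, h3, preimage_univ],
    fun k s => (h4 k s).comp (hθ.measurable_Hsig j), fun k ω hω s hs => h5 k (θ ω) hω s hs⟩

lemma exists_trivial_partition (j : ℕ) : ∃ Γ : ℕ → Set Omega,
    (∀ k, MeasurableSet[Fsig j] (Γ k)) ∧ Pairwise (Function.onFun Disjoint Γ) ∧
      (⋃ k, Γ k) = univ := by
  refine ⟨fun k => {_ω | k = 0}, fun k => MeasurableSet.const _, fun k l hkl => ?_, ?_⟩
  · rw [Function.onFun, Set.disjoint_left]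
    intro ω hk hl
    exact hkl (hk.trans hl.symm)
  · exact iUnion_eq_univ_iff.2 fun ω => ⟨0, rfl⟩

lemma const_mem_admControl1 (π : Partition T) (c : U) : (fun _ _ => c) ∈ AdmControl1 U π := by
  refine ⟨measurable_const, fun j _ => ?_⟩
  obtain ⟨Γ, h1, h2, h3⟩ := exists_trivial_partition j
  exact ⟨Γ, fun _ _ _ => c, h1, h2, h3, fun _ _ => measurable_const, fun _ _ _ _ _ => rfl⟩

lemma const_mem_admControl2 (π : Partition T) (c : V) : (fun _ _ => c) ∈ AdmControl2 V π := by
  refine ⟨measurable_const, fun j _ => ?_⟩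
  obtain ⟨Γ, h1, h2, h3⟩ := exists_trivial_partition j
  exact ⟨Γ, fun _ _ _ => c, h1, h2, h3, fun _ _ => measurable_const, fun _ _ _ _ _ => rfl⟩

lemma isNAD1_const (P : Measure Omega) {π : Partition T} (t : ℝ) {u : ℝ → Omega → U}
    (hu : u ∈ AdmControl1 U π) : IsNAD1 U V P π t fun _ => u :=
  ⟨fun _ _ => hu, fun _ _ _ _ _ _ _ => Eventually.of_forall fun _ _ _ => rfl⟩

lemma isNAD2_const (P : Measure Omega) {π : Partition T} (t : ℝ) {v : ℝ → Omega → V}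
    (hv : v ∈ AdmControl2 V π) : IsNAD2 U V P π t fun _ => v :=
  ⟨fun _ _ => hv, fun _ _ _ _ _ _ _ => Eventually.of_forall fun _ _ _ => rfl⟩

lemma isStoppingIdx_last (π : Partition T) : IsStoppingIdx π fun _ => π.n - 1 :=
  ⟨fun _ => Nat.sub_lt π.npos one_pos, fun _ => MeasurableSet.const _⟩

lemma Partition.t_last_add_one (π : Partition T) : π.t (π.n - 1 + 1) = T := by
  rw [Nat.sub_add_cancel π.npos, π.map_last]

lemma aeStEq_singleton {α : Type*} (P : Measure Omega) [SFinite P] (t : ℝ)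
    (u u' : ℝ → Omega → α) : aeStEq P t (fun _ => t) u u' := by
  have h : ∀ᵐ p ∂(volume : Measure ℝ).prod P, p.1 ≠ t :=
    Measure.quasiMeasurePreserving_fst.ae (compl_mem_ae_iff.2 (measure_singleton t))
  filter_upwards [h] with p hp h1 h2
  exact absurd (le_antisymm h2 h1) hp

lemma IsNAD1.aeEqIcc_last {P : Measure Omega} [SFinite P] {π : Partition T}
    {α : (ℝ → Omega → V) → (ℝ → Omega → U)} (hα : IsNAD1 U V P π (π.t (π.n - 1)) α)
    {v v' : ℝ → Omega → V} (hv : v ∈ AdmControl2 V π) (hv' : v' ∈ AdmControl2 V π) :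
    aeEqIcc P (π.t (π.n - 1)) T (α v) (α v') := by
  filter_upwards [hα.2 _ (isStoppingIdx_last π) v v' hv hv' (aeStEq_singleton P _ v v')]
    with p hp hI
  exact hp hI.1 (hI.2.trans π.t_last_add_one.ge)

lemma IsNAD2.aeEqIcc_last {P : Measure Omega} [SFinite P] {π : Partition T}
    {β : (ℝ → Omega → U) → (ℝ → Omega → V)} (hβ : IsNAD2 U V P π (π.t (π.n - 1)) β)
    {u u' : ℝ → Omega → U} (hu : u ∈ AdmControl1 U π) (hu' : u' ∈ AdmControl1 U π) :
    aeEqIcc P (π.t (π.n - 1)) T (β u) (β u') := by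
  filter_upwards [hβ.2 _ (isStoppingIdx_last π) u u' hu hu' (aeStEq_singleton P _ u u')]
    with p hp hI
  exact hp hI.1 (hI.2.trans π.t_last_add_one.ge)

variable [Nonempty U] [Nonempty V]

/-- On the last interval NAD strategies act like controls: the pay-off does not depend on the
controls at which the strategies are evaluated. -/
lemma payoff_ae_eq_controlPayoff
    (f : ℝ → EuclideanSpace ℝ (Fin d) → U → V → EuclideanSpace ℝ (Fin d))
    (g : EuclideanSpace ℝ (Fin d) → ℝ) {P : Measure Omega} [SFinite P] {π : Partition T}
    (x : EuclideanSpace ℝ (Fin d)) {α : (ℝ → Omega → V) → (ℝ → Omega → U)}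
    {β : (ℝ → Omega → U) → (ℝ → Omega → V)} (hα : IsNAD1 U V P π (π.t (π.n - 1)) α)
    (hβ : IsNAD2 U V P π (π.t (π.n - 1)) β) {u₀ : ℝ → Omega → U} {v₀ : ℝ → Omega → V}
    (hu₀ : u₀ ∈ AdmControl1 U π) (hv₀ : v₀ ∈ AdmControl2 V π) :
    payoff f g P π (π.t (π.n - 1)) x α β
      =ᵐ[P] controlPayoff f g T (π.t (π.n - 1)) x (α v₀) (β u₀) := by
  obtain ⟨hu, hv, hαv, hβu⟩ : IsFixPair P π (π.t (π.n - 1)) T α β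
      (fixPair P π (π.t (π.n - 1)) T α β).1 (fixPair P π (π.t (π.n - 1)) T α β).2 := by
    have hu₁ := hα.1 v₀ hv₀
    have hv₁ := hβ.1 _ hu₁
    exact Classical.epsilon_spec (p := fun p : (ℝ → Omega → U) × (ℝ → Omega → V) =>
      IsFixPair P π (π.t (π.n - 1)) T α β p.1 p.2)
      ⟨(α v₀, β (α v₀)), hu₁, hv₁, hα.aeEqIcc_last hv₁ hv₀, Eventually.of_forall fun _ _ => rfl⟩
  filter_upwards [hαv.ae_ae, hβu.ae_ae, (hα.aeEqIcc_last hv hv₀).ae_ae,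
    (hβ.aeEqIcc_last hu hu₀).ae_ae] with ω h1 h2 h3 h4
  unfold payoff solStrat controlPayoff
  rw [sol_congr]
  · filter_upwards [h1, h3] with s h h' hs
    rw [← h hs, h' hs]
  · filter_upwards [h2, h4] with s h h' hs
    rw [← h hs, h' hs]

lemma abs_condExp_payoff_le {f : ℝ → EuclideanSpace ℝ (Fin d) → U → V → EuclideanSpace ℝ (Fin d)}
    {g : EuclideanSpace ℝ (Fin d) → ℝ} {C : ℝ} (hC : ∀ x, |g x| ≤ C) (P : Measure Omega)
    (π : Partition T) (t : ℝ) (x : EuclideanSpace ℝ (Fin d))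
    (α : (ℝ → Omega → V) → (ℝ → Omega → U)) (β : (ℝ → Omega → U) → (ℝ → Omega → V)) (j : ℕ) :
    ∀ᵐ ω ∂P, |(P[payoff f g P π t x α β | Fsig j]) ω| ≤ C :=
  ae_bdd_abs_condExp_of_ae_bdd_abs (Eventually.of_forall fun _ => hC _)

lemma aemeasurable_condExp_payoff
    {f : ℝ → EuclideanSpace ℝ (Fin d) → U → V → EuclideanSpace ℝ (Fin d)}
    {g : EuclideanSpace ℝ (Fin d) → ℝ} {P : Measure Omega} {π : Partition T} {t : ℝ}
    {x : EuclideanSpace ℝ (Fin d)} (α : (ℝ → Omega → V) → (ℝ → Omega → U))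
    (β : (ℝ → Omega → U) → (ℝ → Omega → V)) (j : ℕ) :
    AEMeasurable (P[payoff f g P π t x α β | Fsig j]) P :=
  (stronglyMeasurable_condExp.mono (Fsig_le j)).measurable.aemeasurable

instance {P : Measure Omega} {π : Partition T} {t : ℝ} : Nonempty {α // IsNAD1 U V P π t α} :=
  ⟨⟨_, isNAD1_const P t (const_mem_admControl1 π (Classical.arbitrary U))⟩⟩

instance {P : Measure Omega} {π : Partition T} {t : ℝ} : Nonempty {β // IsNAD2 U V P π t β} :=
  ⟨⟨_, isNAD2_const P t (const_mem_admControl2 π (Classical.arbitrary V))⟩⟩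

variable {f : ℝ → EuclideanSpace ℝ (Fin d) → U → V → EuclideanSpace ℝ (Fin d)}
  {g : EuclideanSpace ℝ (Fin d) → ℝ} {P : Measure Omega} [IsProbabilityMeasure P]
  {π : Partition T} {t : ℝ} {x : EuclideanSpace ℝ (Fin d)}

lemma isLowerVal_lowerVal (hg : ∃ C : ℝ, ∀ x, |g x| ≤ C) :
    IsLowerVal U V f g P π t x (lowerVal U V f g P π t x) := by
  obtain ⟨C, hC⟩ := hg
  choose J hJm hJb hJ using fun α : {α // IsNAD1 U V P π t α} =>
    exists_isEssInfFam (P := P) (ξ := fun β : {β // IsNAD2 U V P π t β} =>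
      P[payoff f g P π t x α.1 β.1 | Fsig (π.idx t)])
      (fun β => aemeasurable_condExp_payoff _ _ _)
      (fun β => abs_condExp_payoff_le hC P π t x _ _ _)
  obtain ⟨S, -, -, hS⟩ := exists_isEssSupFam (P := P) hJm hJb
  exact Classical.epsilon_spec (p := IsLowerVal U V f g P π t x) ⟨S, J, hJ, hS⟩

lemma IsLowerVal.aemeasurable (hg : ∃ C : ℝ, ∀ x, |g x| ≤ C) {S : Omega → ℝ}
    (hS : IsLowerVal U V f g P π t x S) : AEMeasurable S P := by
  obtain ⟨C, hC⟩ := hg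
  obtain ⟨J, hJ, hS⟩ := hS
  have hJ' (α : {α // IsNAD1 U V P π t α}) :
      AEMeasurable (J α) P ∧ ∀ᵐ ω ∂P, |J α ω| ≤ C := by
    obtain ⟨J', hJm, hJb, hJ'⟩ := exists_isEssInfFam (P := P)
      (ξ := fun β : {β // IsNAD2 U V P π t β} =>
        P[payoff f g P π t x α.1 β.1 | Fsig (π.idx t)])
      (fun β => aemeasurable_condExp_payoff _ _ _)
      (fun β => abs_condExp_payoff_le hC P π t x _ _ _)
    have h := (hJ α).ae_eq hJ'
    refine ⟨hJm.congr h.symm, ?_⟩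
    filter_upwards [hJb, h] with ω h1 h2
    rwa [h2]
  obtain ⟨S', hS'm, -, hS'⟩ :=
    exists_isEssSupFam (P := P) (fun α => (hJ' α).1) (fun α => (hJ' α).2)
  exact hS'm.congr (hS'.ae_eq hS)

/-- At the last grid point the lower value does not decrease under compatible maps. -/
lemma IsLowerVal.ae_le_comp {S : Omega → ℝ}
    (hS : IsLowerVal U V f g P π (π.t (π.n - 1)) x S) {θ θ' : Omega → Omega}
    (hθ : IsCompatible P θ) (hθ' : IsCompatible P θ') (hinv : ∀ᵐ ω ∂P, θ' (θ ω) = ω)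
    (hinv' : ∀ᵐ ω ∂P, θ (θ' ω) = ω) : S ≤ᵐ[P] S ∘ θ := by
  obtain ⟨J, hJ, hS⟩ := hS
  obtain ⟨u₀, hu₀⟩ : ∃ u₀, u₀ ∈ AdmControl1 U π :=
    ⟨_, const_mem_admControl1 π (Classical.arbitrary U)⟩
  obtain ⟨v₀, hv₀⟩ : ∃ v₀, v₀ ∈ AdmControl2 V π :=
    ⟨_, const_mem_admControl2 π (Classical.arbitrary V)⟩
  refine hS.2 _ fun α => ?_
  have hα' := isNAD1_const (V := V) P (π.t (π.n - 1))
    (comp_mem_admControl1 hθ' (α.2.1 _ hv₀))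
  have hJα : J α ∘ θ' ≤ᵐ[P] J ⟨_, hα'⟩ := by
    refine (hJ ⟨_, hα'⟩).2 _ fun β => ?_
    have hβ' := isNAD2_const (U := U) P (π.t (π.n - 1))
      (comp_mem_admControl2 hθ (β.2.1 _ hu₀))
    have hpay : payoff f g P π (π.t (π.n - 1)) x α.1 (fun _ s ω => β.1 u₀ s (θ ω)) ∘ θ'
        =ᵐ[P] payoff f g P π (π.t (π.n - 1)) x (fun _ s ω => α.1 v₀ s (θ' ω)) β.1 := by
      filter_upwards [hθ'.measurePreserving.quasiMeasurePreserving.ae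
          (payoff_ae_eq_controlPayoff f g x α.2 hβ' hu₀ hv₀),
        payoff_ae_eq_controlPayoff f g x hα' β.2 hu₀ hv₀, hinv'] with ω h1 h2 h3
      rw [Function.comp_apply, h1, h2]
      simp only [controlPayoff, h3]
    have hle := hθ'.measurePreserving.quasiMeasurePreserving.ae ((hJ α).1 ⟨_, hβ'⟩)
    filter_upwards [hle, condExp_comp hθ' hθ hinv' hinv (π.idx (π.t (π.n - 1)))
      (payoff f g P π (π.t (π.n - 1)) x α.1 fun _ s ω => β.1 u₀ s (θ ω)),
      condExp_congr_ae (m := Fsig (π.idx (π.t (π.n - 1)))) hpay] with ω h1 h2 h3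
    exact h1.trans (h2.trans h3).le
  have h : J α ∘ θ' ≤ᵐ[P] S := hJα.trans (hS.1 _)
  filter_upwards [hθ.measurePreserving.quasiMeasurePreserving.ae h, hinv] with ω h1 h2
  simpa only [Function.comp_apply, h2] using h1

end LastInterval

/-- **Lemma 3.3.** For a partition `Π = {0 = t_0 < ⋯ < t_n = T}` and every
`x ∈ ℝ^d`, the `𝓕_{n-1}`-measurable random variable
`V^Π(t_{n-1}, x) = esssup_α essinf_β E[g(X_{t_n}^{t_{n-1},x,α,β}) | 𝓕_{n-1}]` is deterministic:
`V^Π(t_{n-1}, x) = E[V^Π(t_{n-1}, x)]`, `P`-a.s. -/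
theorem statement_7
    {d : ℕ} {U V : Type} [MetricSpace U] [CompactSpace U] [MetricSpace V] [CompactSpace V]
    [MeasurableSpace U] [BorelSpace U] [MeasurableSpace V] [BorelSpace V]
    [Nonempty U] [Nonempty V]
    (T : ℝ) (hT : 0 < T)
    (f : ℝ → EuclideanSpace ℝ (Fin d) → U → V → EuclideanSpace ℝ (Fin d))
    (hf_bdd : ∃ C : ℝ, ∀ t x u v, ‖f t x u v‖ ≤ C)
    (hf_cont : ContinuousOn
      (fun q : ℝ × EuclideanSpace ℝ (Fin d) × U × V => f q.1 q.2.1 q.2.2.1 q.2.2.2)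
      (Icc (0 : ℝ) T ×ˢ univ))
    (hf_lip : ∃ K : ℝ≥0, ∀ t u v, LipschitzWith K fun x => f t x u v)
    (g : EuclideanSpace ℝ (Fin d) → ℝ)
    (hg_bdd : ∃ C : ℝ, ∀ x, |g x| ≤ C)
    (hg_lip : ∃ K : ℝ≥0, LipschitzWith K g)
    (P : Measure Omega) [IsProbabilityMeasure P] (hP : IsProductMeasure P)
    (π : Partition T) (x : EuclideanSpace ℝ (Fin d)) :
    lowerVal U V f g P π (π.t (π.n - 1)) x
      =ᵐ[P] fun _ => ∫ ω, lowerVal U V f g P π (π.t (π.n - 1)) x ω ∂P := by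
  have hval := isLowerVal_lowerVal (f := f) (P := P) (π := π) (t := π.t (π.n - 1)) (x := x) hg_bdd
  obtain ⟨c, hc⟩ := ae_eq_const_of_forall_le_rot hP (hval.aemeasurable hg_bdd) fun a =>
    hval.ae_le_comp (isCompatible_rot hP a) (isCompatible_rot hP (-a)) (ae_rot_neg_rot hP a)
      (by simpa using ae_rot_neg_rot hP (-a))
  rw [integral_congr_ae hc]
  simpa using hc

end DGameFormal
end
end
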